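/- Let w ∈ 𝒮_n and suppose there exist three pairwise distinct indices r, s, t with w_r = w_s = w_t and this common value lies in {2, n−1}. Then H_*⟦w_1, …, w_n⟧ = 0, i.e. the complex ⟦w⟧ is acyclic in all degrees. -/

import Mathlib

namespace Nil

/-- Index pairs `(a,b)` with `a < b` in `Fin n`, indexing the basis `e_{ab}` of `nil_n`. -/
abbrev P (n : ℕ) : Type := {p : Fin n × Fin n // p.1 < p.2}

/-- Lexicographic key of a pair. -/
def key {n : ℕ} (p : P n) : ℕ := p.1.1.1 * n + p.1.2.1

/-- Position (0-based) of `a` in the lexicographically sorted list of `M`. -/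
def pos {n : ℕ} (M : Finset (P n)) (a : P n) : ℕ :=
  (M.filter fun b => key b < key a).card

/-- Basis of the degree `k` part of the Chevalley-Eilenberg complex `Λ^* nil_n`:
subsets `M` of pairs with `|M| = k` (empty for `k < 0`). -/
abbrev B (n : ℕ) (k : ℤ) : Type := {M : Finset (P n) // (M.card : ℤ) = k}

/-- Degree `k` chain group of the Chevalley-Eilenberg complex of `nil_n`. -/
abbrev C (n : ℕ) (k : ℤ) : Type := B n k →₀ ℤ

/-- The Chevalley-Eilenberg boundary of a basis wedge `e_M`:
`∂(e_{a₁b₁} ∧ … ∧ e_{aₖbₖ}) = Σ_{i<j} (-1)^{i+j} [e_{aᵢbᵢ}, e_{aⱼbⱼ}] ∧ …` (omitting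
the i-th and j-th factors), written in the lexicographically sorted basis.
For lexicographically sorted wedges the only nonzero brackets come from pairs
`a = (x,y)`, `b = (y,z)`, producing `±e_{(x,z)}`. -/
noncomputable def dAux {n : ℕ} (k : ℤ) (M : Finset (P n)) : C n k :=
  ∑ a ∈ M, ∑ b ∈ M,
    if hab : a.1.2 = b.1.1 then
      (let c : P n := ⟨(a.1.1, b.1.2), lt_trans a.2 (by rw [hab]; exact b.2)⟩
       let M' : Finset (P n) := insert c ((M.erase a).erase b)
       if h' : (M'.card : ℤ) = k then
         ((-1 : ℤ) ^ (pos M a + pos M b + pos M' c)) • Finsupp.single (⟨M', h'⟩ : B n k) 1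
       else 0)
    else 0

/-- The Chevalley-Eilenberg boundary map in degree `k+1`. -/
noncomputable def d (n : ℕ) (k : ℤ) : C n (k + 1) →ₗ[ℤ] C n k :=
  Finsupp.lsum ℤ fun M => LinearMap.toSpanSingleton ℤ (C n k) (dAux k M.1)

/-- Degree-cast isomorphism. -/
noncomputable def castC (n : ℕ) {k l : ℤ} (h : k = l) : C n k ≃ₗ[ℤ] C n l :=
  Finsupp.domLCongr (Equiv.subtypeEquivRight fun _ => by rw [h])

/-- The boundary map out of degree `k`. -/
noncomputable def dFrom (n : ℕ) (k : ℤ) : C n k →ₗ[ℤ] C n (k - 1) :=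
  (d n (k - 1)).comp (castC n (by ring : k = k - 1 + 1)).toLinearMap

/-- Cycles of `Λ^* nil_n` in degree `k`. -/
noncomputable def Zfull (n : ℕ) (k : ℤ) : Submodule ℤ (C n k) := LinearMap.ker (dFrom n k)

noncomputable def HnilSub (n : ℕ) (k : ℤ) : Submodule ℤ (Zfull n k) :=
  Submodule.comap (Zfull n k).subtype (LinearMap.range (d n k) ⊓ Zfull n k)

/-- `H_k(nil_n; ℤ)`: the `k`-th integral homology of the Chevalley-Eilenberg complex
of the Lie ring of strictly upper triangular `n × n` integer matrices. -/
noncomputable def Hnil (n : ℕ) (k : ℤ) : Type := Zfull n k ⧸ HnilSub n k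

noncomputable instance (n : ℕ) (k : ℤ) : AddCommGroup (Hnil n k) :=
  inferInstanceAs (AddCommGroup (Zfull n k ⧸ HnilSub n k))

noncomputable instance (n : ℕ) (k : ℤ) : Module ℤ (Hnil n k) :=
  inferInstanceAs (Module ℤ (Zfull n k ⧸ HnilSub n k))

/-- The modified weight of a basis wedge `e_M` (indices of `Fin n` are 0-based, so the
`i`-th weight of the paper, `1 ≤ i ≤ n`, is `wt M ⟨i-1,_⟩`):
`w_i(e_M) = i - #{x : (x,i) ∈ M} + #{y : (i,y) ∈ M}`. -/
def wt {n : ℕ} (M : Finset (P n)) : Fin n → ℤ := fun i =>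
  ((i.1 : ℤ) + 1) - (M.filter fun p => p.1.2 = i).card + (M.filter fun p => p.1.1 = i).card

/-- Basis wedges of degree `k` and modified weight `w`. -/
abbrev Bw (n : ℕ) (k : ℤ) (w : Fin n → ℤ) : Type :=
  {M : Finset (P n) // (M.card : ℤ) = k ∧ wt M = w}

/-- Degree `k` part of the weight summand `⟦w⟧` of `Λ^* nil_n`. -/
abbrev Cw (n : ℕ) (k : ℤ) (w : Fin n → ℤ) : Type := Bw n k w →₀ ℤ

/-- Inclusion of the weight summand. -/
noncomputable def inclW (n : ℕ) (k : ℤ) (w : Fin n → ℤ) : Cw n k w →ₗ[ℤ] C n k :=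
  Finsupp.lmapDomain ℤ ℤ fun M => (⟨M.1, M.2.1⟩ : B n k)

/-- Projection onto the weight summand. -/
noncomputable def projW (n : ℕ) (k : ℤ) (w : Fin n → ℤ) : C n k →ₗ[ℤ] Cw n k w :=
  Finsupp.lsum ℤ fun M =>
    if h : wt M.1 = w then
      LinearMap.toSpanSingleton ℤ (Cw n k w) (Finsupp.single (⟨M.1, M.2, h⟩ : Bw n k w) 1)
    else 0

/-- The boundary of the weight summand `⟦w⟧` (the boundary preserves weights, so this
is the restriction of the Chevalley-Eilenberg boundary). -/
noncomputable def dW (n : ℕ) (k : ℤ) (w : Fin n → ℤ) : Cw n (k + 1) w →ₗ[ℤ] Cw n k w :=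
  (projW n k w) ∘ₗ (d n k) ∘ₗ (inclW n (k + 1) w)

noncomputable def castCw (n : ℕ) (w : Fin n → ℤ) {k l : ℤ} (h : k = l) :
    Cw n k w ≃ₗ[ℤ] Cw n l w :=
  Finsupp.domLCongr (Equiv.subtypeEquivRight fun _ => by rw [h])

noncomputable def dFromW (n : ℕ) (k : ℤ) (w : Fin n → ℤ) : Cw n k w →ₗ[ℤ] Cw n (k - 1) w :=
  (dW n (k - 1) w).comp (castCw n w (by ring : k = k - 1 + 1)).toLinearMap

noncomputable def ZW (n : ℕ) (k : ℤ) (w : Fin n → ℤ) : Submodule ℤ (Cw n k w) :=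
  LinearMap.ker (dFromW n k w)

noncomputable def HwSub (n : ℕ) (k : ℤ) (w : Fin n → ℤ) : Submodule ℤ (ZW n k w) :=
  Submodule.comap (ZW n k w).subtype (LinearMap.range (dW n k w) ⊓ ZW n k w)

/-- `H_k⟦w⟧`: the `k`-th homology of the weight summand `⟦w⟧` of `Λ^* nil_n`. -/
noncomputable def Hw (n : ℕ) (k : ℤ) (w : Fin n → ℤ) : Type := ZW n k w ⧸ HwSub n k w

noncomputable instance (n : ℕ) (k : ℤ) (w : Fin n → ℤ) : AddCommGroup (Hw n k w) :=
  inferInstanceAs (AddCommGroup (ZW n k w ⧸ HwSub n k w))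

noncomputable instance (n : ℕ) (k : ℤ) (w : Fin n → ℤ) : Module ℤ (Hw n k w) :=
  inferInstanceAs (Module ℤ (ZW n k w ⧸ HwSub n k w))

/-- `w ∈ 𝒮_n`: all entries lie in `{1,…,n}` and they add up to `binom (n+1) 2`. -/
def Sn (n : ℕ) (w : Fin n → ℤ) : Prop :=
  (∀ i, 1 ≤ w i ∧ w i ≤ (n : ℤ)) ∧ 2 * ∑ i, w i = (n : ℤ) * ((n : ℤ) + 1)

/-- Number of inversions of a permutation of `Fin n`. -/
def invCount (n : ℕ) (π : Equiv.Perm (Fin n)) : ℕ :=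
  (Finset.univ.filter fun p : Fin n × Fin n => p.1 < p.2 ∧ π p.2 < π p.1).card

/-- The weight sequence `(π(1), …, π(n))` attached to a permutation (1-based values). -/
def permWt (n : ℕ) (π : Equiv.Perm (Fin n)) : Fin n → ℤ := fun i => ((π i).1 : ℤ) + 1

/-- The set of inversions of a permutation, as a set of index pairs. -/
def invFinset {n : ℕ} (π : Equiv.Perm (Fin n)) : Finset (P n) :=
  Finset.univ.filter fun p => π p.1.2 < π p.1.1

/-- Index reversal `i ↦ n+1-i` (0-based: `i ↦ n-1-i`). -/
def rev {n : ℕ} (i : Fin n) : Fin n := ⟨n - 1 - i.1, by have := i.isLt; omega⟩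


section Exchange

variable {n : ℕ}

/-- The pair `(x,z)` obtained from `(x,y)` and `(y,z)`. -/
def compP (a b : P n) (h : a.1.2 = b.1.1) : P n :=
  ⟨(a.1.1, b.1.2), lt_trans a.2 (by rw [h]; exact b.2)⟩

/-- Replace the pairs `a`, `b` by the pair `c`. -/
def exch (M : Finset (P n)) (a b c : P n) : Finset (P n) := insert c ((M.erase a).erase b)

/-- The sign with which `exch M a b c` occurs in the boundary of `M`. -/
def sgn (M : Finset (P n)) (a b c : P n) : ℤ :=
  (-1) ^ (pos M a + pos M b + pos (exch M a b c) c)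

lemma sgn_mul_self (M : Finset (P n)) (a b c : P n) : sgn M a b c * sgn M a b c = 1 := by
  rw [sgn, ← pow_add, Even.neg_one_pow ⟨_, rfl⟩]

lemma key_injective : Function.Injective (key : P n → ℕ) := by
  rintro ⟨⟨a, b⟩, h⟩ ⟨⟨c, d⟩, h'⟩ e
  simp only [key] at e
  have hb := b.2
  have hd := d.2
  have h1 : a.1 = c.1 := by
    have h2 : (b.1 + n * a.1) / n = (d.1 + n * c.1) / n := by
      congr 1; linarith
    rwa [Nat.add_mul_div_left _ _ (by omega), Nat.add_mul_div_left _ _ (by omega),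
      Nat.div_eq_of_lt hb, Nat.div_eq_of_lt hd, zero_add, zero_add] at h2
  have h3 : b.1 = d.1 := by rw [h1] at e; omega
  simp [Fin.ext_iff, h1, h3]

/-- Indicator of `key u < key v`. -/
def keyLt (u v : P n) : ℕ := if key u < key v then 1 else 0

lemma keyLt_add_keyLt {u v : P n} (h : u ≠ v) : keyLt u v + keyLt v u = 1 := by
  have := key_injective.ne h
  unfold keyLt
  split_ifs <;> omega

lemma pos_eq_sum (M : Finset (P n)) (t : P n) : pos M t = ∑ b ∈ M, keyLt b t := by
  rw [pos, Finset.card_filter]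
  rfl

lemma sum_exch {A : Type*} [AddCommMonoid A] {M : Finset (P n)} {a b c : P n} (f : P n → A)
    (hab : a ≠ b) (ha : a ∈ M) (hb : b ∈ M) (hc : c ∉ M) :
    ∑ x ∈ exch M a b c, f x + (f a + f b) = ∑ x ∈ M, f x + f c := by
  rw [exch, Finset.sum_insert (by simp [hc]), ← Finset.add_sum_erase M f ha,
    ← Finset.add_sum_erase (M.erase a) f (Finset.mem_erase.2 ⟨hab.symm, hb⟩)]
  abel

lemma pos_exch {M : Finset (P n)} {a b c : P n} (hab : a ≠ b) (ha : a ∈ M) (hb : b ∈ M)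
    (hc : c ∉ M) (t : P n) :
    pos (exch M a b c) t + (keyLt a t + keyLt b t) = pos M t + keyLt c t := by
  rw [pos_eq_sum, pos_eq_sum]
  exact sum_exch (fun x => keyLt x t) hab ha hb hc

lemma mem_exch {M : Finset (P n)} {a b c t : P n} :
    t ∈ exch M a b c ↔ t = c ∨ t ≠ b ∧ t ≠ a ∧ t ∈ M := by
  simp [exch]

lemma card_exch {M : Finset (P n)} {a b c : P n} (hab : a ≠ b) (ha : a ∈ M) (hb : b ∈ M)
    (hc : c ∉ M) : (exch M a b c).card + 1 = M.card := by
  have := sum_exch (fun _ => 1) hab ha hb hc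
  simp only [Finset.sum_const, smul_eq_mul, mul_one] at this
  omega

lemma wt_eq_sum (M : Finset (P n)) (i : Fin n) :
    wt M i = (i.1 : ℤ) + 1 +
      ∑ p ∈ M, ((if p.1.1 = i then 1 else 0) - (if p.1.2 = i then 1 else 0) : ℤ) := by
  rw [wt, Finset.card_filter, Finset.card_filter, Finset.sum_sub_distrib]
  push_cast
  ring

lemma wt_exch {M : Finset (P n)} {a b : P n} (h : a.1.2 = b.1.1) (hab : a ≠ b) (ha : a ∈ M)
    (hb : b ∈ M) (hc : compP a b h ∉ M) : wt (exch M a b (compP a b h)) = wt M := by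
  funext i
  let f : P n → ℤ := fun p => (if p.1.1 = i then 1 else 0) - (if p.1.2 = i then 1 else 0)
  have hf : f a + f b = f (compP a b h) := by simp [f, compP, h]
  have hsum := sum_exch f hab ha hb hc
  rw [hf] at hsum
  rw [wt_eq_sum, wt_eq_sum]
  exact congrArg _ (add_right_cancel hsum)

lemma ne_of_composable {a b : P n} (h : a.1.2 = b.1.1) : a ≠ b := by
  rintro rfl
  exact a.2.ne h.symm

lemma compP_ne_left {a b : P n} (h : a.1.2 = b.1.1) : compP a b h ≠ a := by
  intro e
  have h2 : (compP a b h).1.2 = a.1.2 := by rw [e]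
  exact (b.2.trans_eq (h2.trans h)).false

lemma compP_ne_right {a b : P n} (h : a.1.2 = b.1.1) : compP a b h ≠ b := by
  intro e
  have h2 : (compP a b h).1.1 = b.1.1 := by rw [e]
  exact (a.2.trans_eq (h.trans h2.symm)).false

lemma exch_comm {M : Finset (P n)} {a b c p q r : P n}
    (hap : a ≠ r) (hbp : b ≠ r) (hcp : c ≠ p) (hcq : c ≠ q) :
    exch (exch M p q r) a b c = exch (exch M a b c) p q r := by
  ext t
  simp only [mem_exch]
  grind

/-- Two exchanges at disjoint triples of pairs anticommute. -/
lemma sgn_anticomm {M : Finset (P n)} {a b c p q r : P n} (hab : a ≠ b) (hpq : p ≠ q)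
    (ha : a ∈ M) (hb : b ∈ M) (hc : c ∉ M) (hp : p ∈ M) (hq : q ∈ M) (hr : r ∉ M)
    (hap : a ≠ p) (haq : a ≠ q) (har : a ≠ r) (hbp : b ≠ p) (hbq : b ≠ q) (hbr : b ≠ r)
    (hcp : c ≠ p) (hcq : c ≠ q) (hcr : c ≠ r) :
    sgn M p q r * sgn (exch M p q r) a b c = -(sgn M a b c * sgn (exch M a b c) p q r) := by
  have e1 := pos_exch hpq hp hq hr
  have e2 := pos_exch hab ha hb hc
  have e3 := pos_exch (M := exch M p q r) (c := c) hab (mem_exch.2 (.inr ⟨haq, hap, ha⟩))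
    (mem_exch.2 (.inr ⟨hbq, hbp, hb⟩)) (by rw [mem_exch]; tauto) c
  have e4 := pos_exch (M := exch M a b c) (c := r) hpq
    (mem_exch.2 (.inr ⟨hbp.symm, hap.symm, hp⟩))
    (mem_exch.2 (.inr ⟨hbq.symm, haq.symm, hq⟩)) (by rw [mem_exch]; grind) r
  have e1a := e1 a
  have e1b := e1 b
  have e1c := e1 c
  have e1r := e1 r
  have e2p := e2 p
  have e2q := e2 q
  have e2r := e2 r
  have e2c := e2 c
  have := keyLt_add_keyLt hap
  have := keyLt_add_keyLt haq
  have := keyLt_add_keyLt har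
  have := keyLt_add_keyLt hbp
  have := keyLt_add_keyLt hbq
  have := keyLt_add_keyLt hbr
  have := keyLt_add_keyLt hcp
  have := keyLt_add_keyLt hcq
  have := keyLt_add_keyLt hcr
  have neg_one_pow_eq : ∀ k l : ℕ, (k + l) % 2 = 1 → (-1 : ℤ) ^ k = -(-1) ^ l := by
    intro k l h
    rcases Nat.even_or_odd l with h' | h'
    · rw [h'.neg_one_pow, Odd.neg_one_pow]
      grind
    · rw [h'.neg_one_pow, Even.neg_one_pow]
      · simp
      · grind
  simp only [sgn]
  rw [← pow_add, ← pow_add]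
  apply neg_one_pow_eq
  omega

end Exchange

section Ungraded

variable {n : ℕ}

/-- The chain groups of all degrees and weights taken together. -/
abbrev F (n : ℕ) : Type := Finset (P n) →₀ ℤ

/-- The contribution of the pairs `a`, `b` to the boundary of `M`. -/
noncomputable def bterm (M : Finset (P n)) (a b : P n) : F n :=
  if h : a.1.2 = b.1.1 then
    if a ∈ M ∧ b ∈ M ∧ compP a b h ∉ M then
      Finsupp.single (exch M a b (compP a b h)) (sgn M a b (compP a b h))
    else 0
  else 0

/-- The Chevalley-Eilenberg boundary on the ungraded chain group. -/
noncomputable def D (n : ℕ) : F n →ₗ[ℤ] F n :=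
  Finsupp.lsum ℤ fun M => LinearMap.toSpanSingleton ℤ (F n) (∑ ab : P n × P n, bterm M ab.1 ab.2)

lemma D_single (M : Finset (P n)) (x : ℤ) :
    D n (Finsupp.single M x) = x • ∑ ab : P n × P n, bterm M ab.1 ab.2 := by
  simp [D]

/-- The inclusion of a weight summand in the ungraded chain group. -/
noncomputable def toF (n : ℕ) (k : ℤ) (w : Fin n → ℤ) : Cw n k w →ₗ[ℤ] F n :=
  Finsupp.lmapDomain ℤ ℤ Subtype.val

lemma toF_single {k : ℤ} {w : Fin n → ℤ} (M : Bw n k w) (x : ℤ) :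
    toF n k w (Finsupp.single M x) = Finsupp.single M.1 x := by
  simp [toF]

lemma toF_injective (k : ℤ) (w : Fin n → ℤ) : Function.Injective (toF n k w) :=
  Finsupp.mapDomain_injective Subtype.val_injective

lemma toF_projW_single {k : ℤ} {w : Fin n → ℤ} (M : B n k) (hM : wt M.1 = w) :
    toF n k w (projW n k w (Finsupp.single M 1)) = Finsupp.single M.1 1 := by
  simp [projW, hM, toF_single]

lemma dAux_eq (k : ℤ) (M : Finset (P n)) : dAux k M = ∑ a ∈ M, ∑ b ∈ M,
    if h : a.1.2 = b.1.1 then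
      if h' : ((exch M a b (compP a b h)).card : ℤ) = k then
        sgn M a b (compP a b h) • Finsupp.single (⟨exch M a b (compP a b h), h'⟩ : B n k) 1
      else 0
    else 0 := rfl

lemma toF_projW_dAux {k : ℤ} {w : Fin n → ℤ} (M : Bw n (k + 1) w) :
    toF n k w (projW n k w (dAux k M.1)) = D n (Finsupp.single M.1 1) := by
  rw [D_single, one_smul, Fintype.sum_prod_type, dAux_eq, map_sum, map_sum,
    ← Finset.sum_subset (Finset.subset_univ M.1)]
  · refine Finset.sum_congr rfl fun a ha => ?_
    rw [map_sum, map_sum, ← Finset.sum_subset (Finset.subset_univ M.1)]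
    · refine Finset.sum_congr rfl fun b hb => ?_
      unfold bterm
      dsimp only
      by_cases h : a.1.2 = b.1.1
      swap
      · rw [dif_neg h, dif_neg h, map_zero, map_zero]
      rw [dif_pos h, dif_pos h]
      have hab := ne_of_composable h
      by_cases h' : a ∈ M.1 ∧ b ∈ M.1 ∧ compP a b h ∉ M.1
      · have hcard : ((exch M.1 a b (compP a b h)).card : ℤ) = k := by
          have h1 := card_exch hab ha hb h'.2.2
          have h2 := M.2.1
          omega
        rw [dif_pos hcard, if_pos h', LinearMap.map_smul, LinearMap.map_smul,
          toF_projW_single ⟨exch M.1 a b (compP a b h), hcard⟩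
            ((wt_exch h hab ha hb h'.2.2).trans M.2.2), Finsupp.smul_single, smul_eq_mul, mul_one]
      · have hc : compP a b h ∈ M.1 := by tauto
        have hcard : ¬ ((exch M.1 a b (compP a b h)).card : ℤ) = k := by
          have h1 : (exch M.1 a b (compP a b h)).card = M.1.card - 1 - 1 := by
            rw [exch, Finset.insert_eq_of_mem, Finset.card_erase_of_mem,
              Finset.card_erase_of_mem ha]
            · simp [hb, hab.symm]
            · simp [compP_ne_left, compP_ne_right, hc]
          have h2 := M.2.1
          have h3 : 1 < M.1.card := Finset.one_lt_card.2 ⟨a, ha, b, hb, hab⟩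
          omega
        rw [dif_neg hcard, if_neg h', map_zero, map_zero]
    · intro b _ hb
      simp [bterm, hb]
  · intro a _ ha
    simp [bterm, ha]

lemma toF_dW {k : ℤ} {w : Fin n → ℤ} (z : Cw n (k + 1) w) :
    toF n k w (dW n k w z) = D n (toF n (k + 1) w z) := by
  suffices h : (toF n k w).comp (dW n k w) = (D n).comp (toF n (k + 1) w) from
    LinearMap.congr_fun h z
  refine Finsupp.lhom_ext' fun M => LinearMap.ext_ring ?_
  simp only [LinearMap.comp_apply, Finsupp.lsingle_apply, toF_single, ← toF_projW_dAux]
  simp [dW, inclW, d]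

lemma toF_castCw {k l : ℤ} {w : Fin n → ℤ} (h : k = l) (z : Cw n k w) :
    toF n l w (castCw n w h z) = toF n k w z := by
  subst h
  congr 1
  ext M
  simp only [castCw, Finsupp.domLCongr_apply]
  rfl

end Ungraded

section Homotopy

variable {n : ℕ}

/-- Replace the pair `r` by the pairs `p`, `q`. -/
def unexch (M : Finset (P n)) (p q r : P n) : Finset (P n) := insert p (insert q (M.erase r))

lemma mem_unexch {M : Finset (P n)} {p q r t : P n} :
    t ∈ unexch M p q r ↔ t = p ∨ t = q ∨ t ≠ r ∧ t ∈ M := by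
  simp [unexch]

lemma unexch_exch {M : Finset (P n)} {p q r : P n} (hp : p ∈ M) (hq : q ∈ M) (hr : r ∉ M) :
    unexch (exch M p q r) p q r = M := by
  ext t
  simp only [mem_exch, mem_unexch]
  grind

lemma exch_unexch {M : Finset (P n)} {p q r : P n} (hp : p ∉ M) (hq : q ∉ M) (hr : r ∈ M) :
    exch (unexch M p q r) p q r = M := by
  ext t
  simp only [mem_exch, mem_unexch]
  grind

/-- The contracting homotopy on basis elements. -/
noncomputable def hterm (p q r : P n) (M : Finset (P n)) : F n :=
  if r ∈ M ∧ p ∉ M ∧ q ∉ M then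
    Finsupp.single (unexch M p q r) (sgn (unexch M p q r) p q r)
  else 0

/-- The contracting homotopy. -/
noncomputable def H (p q r : P n) : F n →ₗ[ℤ] F n :=
  Finsupp.lsum ℤ fun M => LinearMap.toSpanSingleton ℤ (F n) (hterm p q r M)

lemma H_single (p q r : P n) (M : Finset (P n)) (x : ℤ) :
    H p q r (Finsupp.single M x) = x • hterm p q r M := by
  simp [H]

/-- The only 3-cycles of `M` meeting the pairs `p`, `q`, `pq` are `(p, q)` and its reverse,
and one of these two occurs. -/
structure IsolatedAt (p q : P n) (hpq : p.1.2 = q.1.1) (M : Finset (P n)) : Prop where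
  cyclic : (p ∈ M ∧ q ∈ M ∧ compP p q hpq ∉ M) ∨ (p ∉ M ∧ q ∉ M ∧ compP p q hpq ∈ M)
  isolated : ∀ a b : P n, ∀ h : a.1.2 = b.1.1, a ∈ M → b ∈ M → compP a b h ∉ M →
    (a = p ∧ b = q) ∨ ∀ u ∈ ({a, b, compP a b h} : Finset (P n)),
      u ≠ p ∧ u ≠ q ∧ u ≠ compP p q hpq

lemma bterm_self {p q : P n} {hpq : p.1.2 = q.1.1} {M : Finset (P n)}
    (hp : p ∈ M) (hq : q ∈ M) (hr : compP p q hpq ∉ M) :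
    bterm M p q = Finsupp.single (exch M p q (compP p q hpq)) (sgn M p q (compP p q hpq)) := by
  rw [bterm, dif_pos hpq, if_pos ⟨hp, hq, hr⟩]

lemma homotopy_of_mem {p q : P n} {hpq : p.1.2 = q.1.1} {M : Finset (P n)}
    (hM : IsolatedAt p q hpq M) (hp : p ∈ M) (hq : q ∈ M) (hr : compP p q hpq ∉ M) :
    D n (H p q (compP p q hpq) (Finsupp.single M 1)) +
      H p q (compP p q hpq) (D n (Finsupp.single M 1)) = Finsupp.single M 1 := by
  have h0 : hterm p q (compP p q hpq) M = 0 := by simp [hterm, hr]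
  rw [H_single, h0, smul_zero, map_zero, zero_add, D_single, one_smul, map_sum,
    Finset.sum_eq_single (p, q)]
  · rw [bterm_self hp hq hr, H_single, hterm, if_pos, unexch_exch hp hq hr]
    · simp [sgn_mul_self]
    · have := compP_ne_left hpq
      have := compP_ne_right hpq
      simp only [mem_exch]
      grind
  · rintro ⟨a, b⟩ - hne
    unfold bterm
    split_ifs with h h'
    · obtain ⟨ha, hb, hc⟩ := h'
      have hd := (hM.isolated a b h ha hb hc).resolve_left (by rintro ⟨rfl, rfl⟩; exact hne rfl)
      simp only [Finset.mem_insert, Finset.mem_singleton, forall_eq_or_imp, forall_eq] at hd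
      rw [H_single, hterm, if_neg, smul_zero]
      rintro ⟨-, h1, -⟩
      exact h1 (mem_exch.2 (.inr ⟨hd.2.1.1.symm, hd.1.1.symm, hp⟩))
    · simp
    · simp
  · simp

lemma homotopy_exch {p q : P n} {hpq : p.1.2 = q.1.1} {M : Finset (P n)}
    (hM : IsolatedAt p q hpq M)
    (hM' : IsolatedAt p q hpq (exch M p q (compP p q hpq)))
    (hp : p ∈ M) (hq : q ∈ M) (hr : compP p q hpq ∉ M) :
    D n (H p q (compP p q hpq) (Finsupp.single (exch M p q (compP p q hpq)) 1)) +
      H p q (compP p q hpq) (D n (Finsupp.single (exch M p q (compP p q hpq)) 1)) =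
      Finsupp.single (exch M p q (compP p q hpq)) 1 := by
  have hne := ne_of_composable hpq
  have hrp := compP_ne_left hpq
  have hrq := compP_ne_right hpq
  set r := compP p q hpq with hrdef
  set N := exch M p q r with hN
  have hpN : p ∉ N := by rw [hN, mem_exch]; grind
  have hqN : q ∉ N := by rw [hN, mem_exch]; grind
  have hrN : r ∈ N := by rw [hN, mem_exch]; grind
  have hbN : ∀ t, t ≠ p → t ≠ q → t ≠ r → (t ∈ N ↔ t ∈ M) := by
    intro t; rw [hN, mem_exch]; grind
  rw [H_single, hterm, if_pos ⟨hrN, hpN, hqN⟩, one_smul, hN, unexch_exch hp hq hr, ← hN,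
    D_single, D_single, one_smul, map_sum, Finset.smul_sum, ← Finset.sum_add_distrib,
    Finset.sum_eq_single (p, q)]
  · have : bterm N p q = 0 := by simp [bterm, hpN]
    rw [this, bterm_self hp hq hr, map_zero, add_zero, Finsupp.smul_single, smul_eq_mul,
      sgn_mul_self]
  · rintro ⟨a, b⟩ - hne'
    have hne'' : ¬ (a = p ∧ b = q) := by rintro ⟨rfl, rfl⟩; exact hne' rfl
    dsimp only
    by_cases h : a.1.2 = b.1.1
    swap
    · simp [bterm, h]
    set c := compP a b h with hc
    have hab := ne_of_composable h
    by_cases hd : ∀ u ∈ ({a, b, c} : Finset (P n)), u ≠ p ∧ u ≠ q ∧ u ≠ r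
    · simp only [Finset.mem_insert, Finset.mem_singleton, forall_eq_or_imp, forall_eq] at hd
      obtain ⟨⟨hap, haq, har⟩, ⟨hbp, hbq, hbr⟩, ⟨hcp, hcq, hcr⟩⟩ := hd
      rw [bterm, bterm, dif_pos h, dif_pos h, ← hc]
      simp only [hbN a hap haq har, hbN b hbp hbq hbr, hbN c hcp hcq hcr]
      by_cases h' : a ∈ M ∧ b ∈ M ∧ c ∉ M
      swap
      · simp [h']
      obtain ⟨ha, hb, hcM⟩ := h'
      have hp' : p ∈ exch M a b c := mem_exch.2 (.inr ⟨hbp.symm, hap.symm, hp⟩)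
      have hq' : q ∈ exch M a b c := mem_exch.2 (.inr ⟨hbq.symm, haq.symm, hq⟩)
      have hr' : r ∉ exch M a b c := by rw [mem_exch]; grind
      have hsg := sgn_anticomm hab hne ha hb hcM hp hq hr hap haq har hbp hbq hbr hcp hcq hcr
      rw [if_pos ⟨ha, hb, hcM⟩, if_pos ⟨ha, hb, hcM⟩, hN, exch_comm har hbr hcp hcq, H_single,
        hterm, if_pos, unexch_exch hp' hq' hr', Finsupp.smul_single, Finsupp.smul_single,
        ← Finsupp.single_add, Finsupp.single_eq_zero, smul_eq_mul, smul_eq_mul]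
      · have e1 := sgn_mul_self M a b c
        have e2 := sgn_mul_self (exch M p q r) a b c
        linear_combination (sgn M a b c * sgn (exch M p q r) a b c) * hsg
          - (sgn M p q r * sgn M a b c) * e2
          - (sgn (exch M p q r) a b c * sgn (exch M a b c) p q r) * e1
      · simp only [mem_exch]
        grind
    · have z1 : bterm M a b = 0 := by
        rw [bterm, dif_pos h, if_neg]
        rintro ⟨ha, hb, hcM⟩
        exact (hM.isolated a b h ha hb hcM).elim hne'' hd
      have z2 : bterm N a b = 0 := by
        rw [bterm, dif_pos h, if_neg]
        rintro ⟨ha, hb, hcM⟩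
        exact (hM'.isolated a b h ha hb hcM).elim hne'' hd
      rw [z1, z2, smul_zero, map_zero, add_zero]
  · simp

lemma wt_unexch {p q : P n} {hpq : p.1.2 = q.1.1} {M : Finset (P n)}
    (hp : p ∉ M) (hq : q ∉ M) (hr : compP p q hpq ∈ M) :
    wt (unexch M p q (compP p q hpq)) = wt M := by
  have h1 := compP_ne_left hpq
  have h2 := compP_ne_right hpq
  rw [← wt_exch hpq (ne_of_composable hpq), exch_unexch hp hq hr] <;>
  · simp only [mem_unexch]
    grind

lemma card_unexch {p q : P n} {hpq : p.1.2 = q.1.1} {M : Finset (P n)}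
    (hp : p ∉ M) (hq : q ∉ M) (hr : compP p q hpq ∈ M) :
    (unexch M p q (compP p q hpq)).card = M.card + 1 := by
  have h1 := compP_ne_left hpq
  have h2 := compP_ne_right hpq
  rw [← card_exch (c := compP p q hpq) (ne_of_composable hpq), exch_unexch hp hq hr] <;>
  · simp only [mem_unexch]
    grind

lemma homotopy {p q : P n} {hpq : p.1.2 = q.1.1} {w : Fin n → ℤ}
    (hiso : ∀ M : Finset (P n), wt M = w → IsolatedAt p q hpq M) {M : Finset (P n)}
    (hM : wt M = w) :
    D n (H p q (compP p q hpq) (Finsupp.single M 1)) +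
      H p q (compP p q hpq) (D n (Finsupp.single M 1)) = Finsupp.single M 1 := by
  rcases (hiso M hM).cyclic with ⟨hp, hq, hr⟩ | ⟨hp, hq, hr⟩
  · exact homotopy_of_mem (hiso M hM) hp hq hr
  · have h1 := compP_ne_left hpq
    have h2 := compP_ne_right hpq
    have e := exch_unexch hp hq hr
    have := homotopy_exch (M := unexch M p q (compP p q hpq))
      (hiso _ ((wt_unexch hp hq hr).trans hM)) (by rw [e]; exact hiso M hM)
      (by simp [mem_unexch]) (by simp [mem_unexch]) (by simp [mem_unexch, h1, h2])
    rwa [e] at this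

lemma H_toF_mem_range {p q : P n} {hpq : p.1.2 = q.1.1} {k : ℤ} {w : Fin n → ℤ}
    (z : Cw n k w) :
    H p q (compP p q hpq) (toF n k w z) ∈ LinearMap.range (toF n (k + 1) w) := by
  induction z using Finsupp.induction_linear with
  | zero => simp
  | add f g hf hg => rw [map_add, map_add]; exact add_mem hf hg
  | single M x =>
    rw [toF_single, H_single]
    refine Submodule.smul_mem _ _ ?_
    unfold hterm
    split_ifs with h
    · obtain ⟨hr, hp, hq⟩ := h
      refine ⟨Finsupp.single ⟨_, ?_, (wt_unexch hp hq hr).trans M.2.2⟩ _, toF_single _ _⟩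
      rw [card_unexch hp hq hr]
      have := M.2.1
      omega
    · exact zero_mem _

theorem subsingleton_Hw_of_isolatedAt {p q : P n} {hpq : p.1.2 = q.1.1} {w : Fin n → ℤ}
    (hiso : ∀ M : Finset (P n), wt M = w → IsolatedAt p q hpq M) (k : ℤ) :
    Subsingleton (Hw n k w) := by
  have hhom : ∀ z : Cw n k w, D n (H p q (compP p q hpq) (toF n k w z)) +
      H p q (compP p q hpq) (D n (toF n k w z)) = toF n k w z := by
    intro z
    suffices h : ((D n).comp (H p q (compP p q hpq)) + (H p q (compP p q hpq)).comp (D n)).comp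
        (toF n k w) = toF n k w from LinearMap.congr_fun h z
    refine Finsupp.lhom_ext' fun M => LinearMap.ext_ring ?_
    simpa only [LinearMap.comp_apply, LinearMap.add_apply, Finsupp.lsingle_apply, toF_single]
      using homotopy hiso M.2.2
  refine Submodule.Quotient.subsingleton_iff.2 (eq_top_iff.2 ?_)
  rintro ⟨z, hz⟩ -
  refine ⟨?_, hz⟩
  have hDz : D n (toF n k w z) = 0 := by
    have hz' : dW n (k - 1) w (castCw n w (by ring) z) = 0 := hz
    rw [← toF_castCw (by ring : k = k - 1 + 1), ← toF_dW, hz', map_zero]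
  obtain ⟨y, hy⟩ := H_toF_mem_range (p := p) (q := q) (hpq := hpq) z
  refine ⟨y, toF_injective k w ?_⟩
  have := hhom z
  rw [hDz, map_zero, add_zero, ← hy] at this
  rw [toF_dW, this]
  rfl

end Homotopy

section Tournament

variable {n : ℕ}

/-- The tournament on `Fin n` attached to `M`: the larger index beats the smaller one unless
the pair lies in `M`. -/
def Beats (M : Finset (P n)) (i j : Fin n) : Prop :=
  (∃ h : i < j, (⟨(i, j), h⟩ : P n) ∈ M) ∨ (∃ h : j < i, (⟨(j, i), h⟩ : P n) ∉ M)

lemma beats_of_lt {M : Finset (P n)} {i j : Fin n} (h : i < j) :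
    Beats M i j ↔ (⟨(i, j), h⟩ : P n) ∈ M := by
  simp [Beats, h, h.not_gt]

lemma beats_of_gt {M : Finset (P n)} {i j : Fin n} (h : j < i) :
    Beats M i j ↔ (⟨(j, i), h⟩ : P n) ∉ M := by
  simp [Beats, h, h.not_gt]

lemma not_beats_self (M : Finset (P n)) (i : Fin n) : ¬ Beats M i i := by
  simp [Beats]

lemma beats_iff_not {M : Finset (P n)} {i j : Fin n} (h : i ≠ j) :
    Beats M i j ↔ ¬ Beats M j i := by
  rcases lt_or_gt_of_ne h with h | h
  · rw [beats_of_lt h, beats_of_gt h, not_not]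
  · rw [beats_of_gt h, beats_of_lt h]

open Classical in
lemma wt_eq_card_beats (M : Finset (P n)) (i : Fin n) :
    wt M i = 1 + ((Finset.univ.filter (Beats M i)).card : ℤ) := by
  have hout : (M.filter fun p => p.1.1 = i).card =
      (Finset.univ.filter fun j => i < j ∧ Beats M i j).card := by
    refine Finset.card_bij (fun p _ => p.1.2) ?_ ?_ ?_
    · rintro ⟨⟨a, b⟩, h⟩ hp
      simp only [Finset.mem_filter] at hp
      obtain ⟨hp, rfl⟩ := hp
      simpa using ⟨h, (beats_of_lt h).2 hp⟩
    · rintro ⟨⟨a, b⟩, h⟩ hp ⟨⟨a', b'⟩, h'⟩ hp' e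
      simp only [Finset.mem_filter] at hp hp' e
      simp [e, hp.2, hp'.2]
    · intro j hj
      simp only [Finset.mem_filter, Finset.mem_univ, true_and] at hj
      exact ⟨⟨(i, j), hj.1⟩, by simpa using (beats_of_lt hj.1).1 hj.2, rfl⟩
  have hin : (M.filter fun p => p.1.2 = i).card =
      (Finset.univ.filter fun j => j < i ∧ ¬ Beats M i j).card := by
    refine Finset.card_bij (fun p _ => p.1.1) ?_ ?_ ?_
    · rintro ⟨⟨a, b⟩, h⟩ hp
      simp only [Finset.mem_filter] at hp
      obtain ⟨hp, rfl⟩ := hp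
      simpa [h] using (beats_of_gt h).not.2 (not_not.2 hp)
    · rintro ⟨⟨a, b⟩, h⟩ hp ⟨⟨a', b'⟩, h'⟩ hp' e
      simp only [Finset.mem_filter] at hp hp' e
      simp [e, hp.2, hp'.2]
    · intro j hj
      simp only [Finset.mem_filter, Finset.mem_univ, true_and] at hj
      exact ⟨⟨(j, i), hj.1⟩, by simpa using (beats_of_gt hj.1).not.1 hj.2, rfl⟩
  have hlow : (Finset.univ.filter fun j => j < i ∧ Beats M i j).card +
      (Finset.univ.filter fun j => j < i ∧ ¬ Beats M i j).card = i.1 := by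
    rw [← Finset.filter_filter, ← Finset.filter_filter, Finset.card_filter_add_card_filter_not,
      Finset.filter_gt_eq_Iio, Fin.card_Iio]
  have hall : (Finset.univ.filter (Beats M i)).card =
      (Finset.univ.filter fun j => j < i ∧ Beats M i j).card +
      (Finset.univ.filter fun j => i < j ∧ Beats M i j).card := by
    rw [← Finset.card_union_of_disjoint]
    · congr 1
      ext j
      have : Beats M i j → j ≠ i := by rintro h rfl; exact not_beats_self _ _ h
      simp only [Finset.mem_filter, Finset.mem_univ, true_and, Finset.mem_union]
      grind
    · rw [Finset.disjoint_filter]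
      intro j _ h h'
      exact h.1.not_gt h'.1
  rw [wt, hout, hin, hall, ← hlow]
  push_cast
  ring

open Classical in
lemma card_beats_add_card_beaten (M : Finset (P n)) (i : Fin n) :
    (Finset.univ.filter (Beats M i)).card + (Finset.univ.filter fun j => Beats M j i).card + 1
      = n := by
  have h := Finset.card_filter_add_card_filter_not (s := (Finset.univ : Finset (Fin n)))
    (Beats M i)
  have h2 : (Finset.univ.filter fun j => ¬ Beats M i j) =
      insert i (Finset.univ.filter fun j => Beats M j i) := by
    ext j
    simp only [Finset.mem_filter, Finset.mem_univ, true_and, Finset.mem_insert]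
    by_cases hj : j = i
    · subst hj; simp [not_beats_self]
    · simp [hj, beats_iff_not hj]
  rw [h2, Finset.card_insert_of_notMem (by simp [not_beats_self])] at h
  simpa [add_assoc] using h

open Classical in
lemma existsUnique_beats_of_wt_eq {M : Finset (P n)} {i : Fin n} (h : wt M i = 2) :
    ∃! j, Beats M i j := by
  rw [wt_eq_card_beats] at h
  have : (Finset.univ.filter (Beats M i)).card = 1 := by omega
  simpa [Finset.card_eq_one, Finset.eq_singleton_iff_unique_mem, ExistsUnique] using this

open Classical in
lemma existsUnique_beaten_of_wt_eq {M : Finset (P n)} {i : Fin n} (h : wt M i = (n : ℤ) - 1) :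
    ∃! j, Beats M j i := by
  rw [wt_eq_card_beats] at h
  have h' := card_beats_add_card_beaten M i
  have : (Finset.univ.filter fun j => Beats M j i).card = 1 := by omega
  simpa [Finset.card_eq_one, Finset.eq_singleton_iff_unique_mem, ExistsUnique] using this

/-- In a tournament, three vertices with exactly one successor each form a 3-cycle which is
closed under successors. -/
lemma cyclic_and_closed_of_existsUnique {V : Type*} {R : V → V → Prop}
    (hR : ∀ i j, i ≠ j → (R i j ↔ ¬ R j i)) {x y z : V} (hxy : x ≠ y) (hyz : y ≠ z)
    (hxz : x ≠ z) (hx : ∃! j, R x j) (hy : ∃! j, R y j) (hz : ∃! j, R z j) :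
    ((R x y ∧ R y z ∧ R z x) ∨ (R y x ∧ R z y ∧ R x z)) ∧
      ∀ i v, (i = x ∨ i = y ∨ i = z) → R i v → v = x ∨ v = y ∨ v = z := by
  have h1 := hR x y hxy
  have h2 := hR y z hyz
  have h3 := hR x z hxz
  have ux := fun j k (hj : R x j) (hk : R x k) => hx.unique hj hk
  have uy := fun j k (hj : R y j) (hk : R y k) => hy.unique hj hk
  have uz := fun j k (hj : R z j) (hk : R z k) => hz.unique hj hk
  have hc : (R x y ∧ R y z ∧ R z x) ∨ (R y x ∧ R z y ∧ R x z) := by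
    have := ux y z
    have := uy x z
    have := uz x y
    tauto
  refine ⟨hc, ?_⟩
  rintro i v (rfl | rfl | rfl) hv <;> rcases hc with ⟨c1, c2, c3⟩ | ⟨c1, c2, c3⟩
  · exact .inr (.inl (ux _ _ hv c1))
  · exact .inr (.inr (ux _ _ hv c3))
  · exact .inr (.inr (uy _ _ hv c2))
  · exact .inl (uy _ _ hv c1)
  · exact .inl (uz _ _ hv c3)
  · exact .inr (.inl (uz _ _ hv c2))

lemma isolatedAt_of_relation {M : Finset (P n)} {x y z : Fin n} (hxy : x < y) (hyz : y < z)
    (hc : (Beats M x y ∧ Beats M y z ∧ Beats M z x) ∨ (Beats M y x ∧ Beats M z y ∧ Beats M x z))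
    (hclosed : ∀ i j k, Beats M i j → Beats M j k → Beats M k i →
      (i = x ∨ i = y ∨ i = z) → (j = x ∨ j = y ∨ j = z) ∧ (k = x ∨ k = y ∨ k = z)) :
    IsolatedAt (⟨(x, y), hxy⟩ : P n) ⟨(y, z), hyz⟩ rfl M where
  cyclic := by
    have hxz := hxy.trans hyz
    simp only [beats_of_lt hxy, beats_of_lt hyz, beats_of_lt hxz, beats_of_gt hxy,
      beats_of_gt hyz, beats_of_gt hxz] at hc
    exact hc
  isolated := by
    rintro ⟨⟨i, j⟩, hij⟩ ⟨⟨j', k⟩, hjk⟩ h ha hb hab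
    obtain rfl : j = j' := h
    dsimp only at hij hjk
    have b1 : Beats M i j := (beats_of_lt hij).2 ha
    have b2 : Beats M j k := (beats_of_lt hjk).2 hb
    have b3 : Beats M k i := (beats_of_gt (hij.trans hjk)).2 hab
    have c1 := hclosed i j k b1 b2 b3
    have c2 := hclosed j k i b2 b3 b1
    have c3 := hclosed k i j b3 b1 b2
    by_cases hi : i = x ∨ i = y ∨ i = z
    · left
      obtain ⟨hj, hk⟩ := c1 hi
      simp only [Subtype.mk.injEq, Prod.mk.injEq]
      simp only [Fin.ext_iff, Fin.lt_def] at *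
      omega
    · right
      have hj : ¬ (j = x ∨ j = y ∨ j = z) := fun hj => hi (c2 hj).2
      have hk : ¬ (k = x ∨ k = y ∨ k = z) := fun hk => hi (c3 hk).1
      simp only [Finset.mem_insert, Finset.mem_singleton, forall_eq_or_imp, forall_eq, compP,
        ne_eq, Subtype.mk.injEq, Prod.mk.injEq]
      push Not at hi hj hk
      simp [hi, hj, hk]

lemma isolatedAt_of_wt {w : Fin n → ℤ} {x y z : Fin n} (hxy : x < y) (hyz : y < z)
    (h1 : w x = w y) (h2 : w y = w z) (hval : w x = 2 ∨ w x = (n : ℤ) - 1)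
    (M : Finset (P n)) (hM : wt M = w) :
    IsolatedAt (⟨(x, y), hxy⟩ : P n) ⟨(y, z), hyz⟩ rfl M := by
  subst hM
  have hR : ∀ i j, i ≠ j → (Beats M i j ↔ ¬ Beats M j i) := fun i j h => beats_iff_not h
  have hxz := hxy.trans hyz
  rcases hval with h | h
  · obtain ⟨hc, hcl⟩ := cyclic_and_closed_of_existsUnique hR hxy.ne hyz.ne hxz.ne
      (existsUnique_beats_of_wt_eq h) (existsUnique_beats_of_wt_eq (h1.symm.trans h))
      (existsUnique_beats_of_wt_eq ((h1.trans h2).symm.trans h))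
    refine isolatedAt_of_relation hxy hyz hc fun i j k b1 b2 _ hi => ?_
    have hj := hcl i j hi b1
    exact ⟨hj, hcl j k hj b2⟩
  · obtain ⟨hc, hcl⟩ := cyclic_and_closed_of_existsUnique (R := fun i j => Beats M j i)
      (fun i j h => hR j i h.symm) hxy.ne hyz.ne hxz.ne
      (existsUnique_beaten_of_wt_eq h) (existsUnique_beaten_of_wt_eq (h1.symm.trans h))
      (existsUnique_beaten_of_wt_eq ((h1.trans h2).symm.trans h))
    refine isolatedAt_of_relation hxy hyz hc.symm fun i j k _ b2 b3 hi => ?_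
    have hk := hcl i k hi b3
    exact ⟨hcl k j hk b2, hk⟩

end Tournament

/-- Lemma 3.1: if three pairwise distinct entries of `w ∈ 𝒮_n` are equal with common value
in `{2, n-1}`, then `H_*⟦w⟧ = 0`. -/
theorem triple_repeat_acyclic (n : ℕ) (w : Fin n → ℤ) (hw : Sn n w) (r s t : Fin n)
    (hrs : r ≠ s) (hrt : r ≠ t) (hst : s ≠ t)
    (h1 : w r = w s) (h2 : w s = w t) (hval : w r = 2 ∨ w r = (n : ℤ) - 1) :
    ∀ k : ℤ, Subsingleton (Hw n k w) := by
  intro k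
  obtain ⟨x, y, z, hxy, hyz, e1, e2, e3⟩ : ∃ x y z, x < y ∧ y < z ∧ w x = w r ∧ w y = w r ∧
      w z = w r := by
    have h3 := h1.trans h2
    rcases lt_or_gt_of_ne hrs with a | a <;> rcases lt_or_gt_of_ne hrt with b | b <;>
      rcases lt_or_gt_of_ne hst with c | c
    · exact ⟨r, s, t, a, c, rfl, h1.symm, h3.symm⟩
    · exact ⟨r, t, s, b, c, rfl, h3.symm, h1.symm⟩
    · exact absurd (a.trans c) b.not_gt
    · exact ⟨t, r, s, b, a, h3.symm, rfl, h1.symm⟩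
    · exact ⟨s, r, t, a, b, h1.symm, rfl, h3.symm⟩
    · exact absurd (c.trans a) b.not_gt
    · exact ⟨s, t, r, c, b, h1.symm, h3.symm, rfl⟩
    · exact ⟨t, s, r, c, a, h3.symm, h1.symm, rfl⟩
  exact subsingleton_Hw_of_isolatedAt
    (isolatedAt_of_wt hxy hyz (e1.trans e2.symm) (e2.trans e3.symm) (e1 ▸ hval)) k

end Nil
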